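/- Let n ∈ ℕ, 1 < p, q < ∞, 0 < r < ∞ with p + q ≥ r, let δ ∈ [0,1] ∩ [(r−q)/r, p/r], and let a, b, c ∈ ℝ satisfy δr/p + (1−δ)r/q = 1, n = p(1−a), and c = δ(a−1) + b(1−δ). Then for every f ∈ C_0^∞(ℝ^n \ {0}), ‖|x|^c f‖_{L^r(ℝ^n)} ≤ p^δ · ‖|x|^a (log|x|) ∇f‖_{L^p(ℝ^n)}^δ · ‖|x|^b f‖_{L^q(ℝ^n)}^{1−δ}. -/

import Mathlib

open Real MeasureTheory

lemma aux_cont {E : Type*} [NormedAddCommGroup E] {w g : E → ℝ} (hw : ContinuousOn w {0}ᶜ)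
    (hg : Continuous g) {ε : ℝ} (hε : 0 < ε) (h0 : ∀ x : E, ‖x‖ < ε → g x = 0) :
    Continuous (fun x => w x * g x) := by
  rw [continuous_iff_continuousAt]
  intro x
  by_cases hx : x = 0
  · subst hx
    have : (fun x => w x * g x) =ᶠ[nhds 0] fun _ => 0 := by
      filter_upwards [Metric.ball_mem_nhds (0:E) hε] with y hy
      rw [h0 y (by simpa using hy), mul_zero]
    exact continuousAt_const.congr this.symm
  · exact (hw.continuousAt (isOpen_compl_singleton.mem_nhds hx)).mul hg.continuousAt

/-- the integral of the divergence of `φ x • x`. -/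
lemma aux_div {n : ℕ} {φ : EuclideanSpace ℝ (Fin n) → ℝ} (hφ : ContDiff ℝ 1 φ)
    (hs : HasCompactSupport φ) :
    ∫ x, fderiv ℝ φ x x = - (n:ℝ) * ∫ x, φ x := by
  have hcd : Continuous (fderiv ℝ φ) := hφ.continuous_fderiv (by norm_num)
  have hsd : HasCompactSupport (fderiv ℝ φ) := hs.fderiv (𝕜 := ℝ)
  have key : ∀ i : Fin n, Integrable (fun x : EuclideanSpace ℝ (Fin n) =>
      x i * fderiv ℝ φ x (EuclideanSpace.single i (1:ℝ))) ∧
      ∫ x : EuclideanSpace ℝ (Fin n), x i * fderiv ℝ φ x (EuclideanSpace.single i (1:ℝ))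
        = - ∫ x, φ x := by
    intro i
    have hL : ∀ x : EuclideanSpace ℝ (Fin n), HasFDerivAt (fun x : EuclideanSpace ℝ (Fin n) => x i)
      (EuclideanSpace.proj i : EuclideanSpace ℝ (Fin n) →L[ℝ] ℝ) x := fun x =>
        (EuclideanSpace.proj i : EuclideanSpace ℝ (Fin n) →L[ℝ] ℝ).hasFDerivAt
    have hLc : Continuous (fun x : EuclideanSpace ℝ (Fin n) => x i) :=
      (EuclideanSpace.proj i : EuclideanSpace ℝ (Fin n) →L[ℝ] ℝ).continuous
    have hsd' : HasCompactSupport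
        (fun x => fderiv ℝ φ x (EuclideanSpace.single i (1:ℝ))) := by
      exact hsd.comp_left (g := fun L : EuclideanSpace ℝ (Fin n) →L[ℝ] ℝ => L (EuclideanSpace.single i (1:ℝ))) (by simp)
    have hcd' : Continuous (fun x => fderiv ℝ φ x (EuclideanSpace.single i (1:ℝ))) := by fun_prop
    have hI : Integrable (fun x : EuclideanSpace ℝ (Fin n) =>
      x i * fderiv ℝ φ x (EuclideanSpace.single i (1:ℝ))) :=
        (hLc.mul hcd').integrable_of_hasCompactSupport (hsd'.mul_left)
    refine ⟨hI, ?_⟩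
    rw [integral_mul_fderiv_eq_neg_fderiv_mul_of_integrable]
    · congr 1
      refine integral_congr_ae (Filter.Eventually.of_forall fun x => ?_)
      simp [(hL x).fderiv]
    · have : (fun x : EuclideanSpace ℝ (Fin n) => fderiv ℝ (fun x : EuclideanSpace ℝ (Fin n) => x i) x (EuclideanSpace.single i (1:ℝ)) * φ x) = φ := by
        ext x; simp [(hL x).fderiv]
      rw [this]
      exact hφ.continuous.integrable_of_hasCompactSupport hs
    · exact hI
    · exact (hLc.mul hφ.continuous).integrable_of_hasCompactSupport (hs.mul_left)
    · exact fun x _ => (hL x).differentiableAt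
    · exact fun x _ => hφ.differentiable (by norm_num) x
  have hsum : ∀ x : EuclideanSpace ℝ (Fin n), fderiv ℝ φ x x =
      ∑ i, x i * fderiv ℝ φ x (EuclideanSpace.single i (1:ℝ)) := by
    intro x
    have hx : x = ∑ i, x i • EuclideanSpace.single i (1:ℝ) := by
      ext j; simp [Finset.sum_apply, Pi.single_apply]
    have h2 := congrArg (fderiv ℝ φ x) hx
    rw [map_sum] at h2
    simpa using h2
  simp_rw [hsum]
  rw [integral_finsetSum _ fun i _ => (key i).1]
  simp [(key _).2]

lemma aux_interp {E : Type*} [MeasurableSpace E] {μ : Measure E} {u v : E → ℝ} {p q r δ : ℝ}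
    (hu : ∀ x, 0 ≤ u x) (hv : ∀ x, 0 ≤ v x) (hp : 1 < p) (hq : 1 < q) (hr : 0 < r)
    (hδ0 : 0 < δ) (hδ1 : δ < 1) (h1 : δ * r / p + (1 - δ) * r / q = 1)
    (hmu : MemLp (fun x => u x ^ (δ * r)) (ENNReal.ofReal (p / (δ * r))) μ)
    (hmv : MemLp (fun x => v x ^ ((1 - δ) * r)) (ENNReal.ofReal (q / ((1 - δ) * r))) μ) :
    (∫ x, (u x ^ δ * v x ^ (1 - δ)) ^ r ∂μ) ^ (1 / r) ≤
      ((∫ x, u x ^ p ∂μ) ^ (1 / p)) ^ δ * ((∫ x, v x ^ q ∂μ) ^ (1 / q)) ^ (1 - δ) := by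
  have hd : 0 < 1 - δ := by linarith
  have hp0 : 0 < p := by linarith
  have hq0 : 0 < q := by linarith
  have hpq : (p / (δ * r)).HolderConjugate (q / ((1 - δ) * r)) := by
    refine ⟨?_, by positivity, by positivity⟩
    rw [inv_div, inv_div, h1, inv_one]
  have := integral_mul_le_Lp_mul_Lq_of_nonneg hpq
    (Filter.Eventually.of_forall fun x => rpow_nonneg (hu x) _)
    (Filter.Eventually.of_forall fun x => rpow_nonneg (hv x) _) hmu hmv
  have e1 : ∀ x, (u x ^ (δ * r)) ^ (p / (δ * r)) = u x ^ p := by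
    intro x; rw [← rpow_mul (hu x)]; congr 1; field_simp
  have e2 : ∀ x, (v x ^ ((1 - δ) * r)) ^ (q / ((1 - δ) * r)) = v x ^ q := by
    intro x; rw [← rpow_mul (hv x)]; congr 1; field_simp
  have e3 : ∀ x, (u x ^ δ * v x ^ (1 - δ)) ^ r = u x ^ (δ * r) * v x ^ ((1 - δ) * r) := by
    intro x; rw [mul_rpow (rpow_nonneg (hu x) _) (rpow_nonneg (hv x) _), ← rpow_mul (hu x),
      ← rpow_mul (hv x)]
  simp_rw [e1, e2, ← e3] at this
  have A0 : 0 ≤ ∫ x, u x ^ p ∂μ := integral_nonneg fun x => rpow_nonneg (hu x) _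
  have B0 : 0 ≤ ∫ x, v x ^ q ∂μ := integral_nonneg fun x => rpow_nonneg (hv x) _
  have C0 : 0 ≤ ∫ x, (u x ^ δ * v x ^ (1 - δ)) ^ r ∂μ := integral_nonneg fun x =>
    rpow_nonneg (mul_nonneg (rpow_nonneg (hu x) _) (rpow_nonneg (hv x) _)) _
  refine (rpow_le_rpow C0 this (by positivity)).trans (le_of_eq ?_)
  rw [mul_rpow (by positivity) (by positivity), ← rpow_mul A0, ← rpow_mul B0, ← rpow_mul A0,
    ← rpow_mul B0]
  congr 2 <;> field_simp

lemma aux_contDiff {n : ℕ} {p s : ℝ} (hp : 1 < p) {f : EuclideanSpace ℝ (Fin n) → ℝ}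
    (hf : ContDiff ℝ 1 f) {ε : ℝ} (hε : 0 < ε) (h0 : ∀ x, ‖x‖ < ε → f x = 0) :
    ContDiff ℝ 1 (fun x => Real.log ‖x‖ * ‖x‖ ^ s * |f x| ^ p) := by
  rw [contDiff_iff_contDiffAt]
  intro x
  by_cases hx : x = 0
  · subst hx
    have : (fun x => Real.log ‖x‖ * ‖x‖ ^ s * |f x| ^ p) =ᶠ[nhds 0] fun _ => 0 := by
      filter_upwards [Metric.ball_mem_nhds (0:EuclideanSpace ℝ (Fin n)) hε] with y hy
      rw [h0 y (by simpa using hy), abs_zero, zero_rpow (by linarith), mul_zero]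
    exact contDiffAt_const.congr_of_eventuallyEq this
  · have hn : ‖x‖ ≠ 0 := norm_ne_zero_iff.mpr hx
    have h1 : ContDiffAt ℝ 1 (fun x : EuclideanSpace ℝ (Fin n) => ‖x‖) x := contDiffAt_norm ℝ hx
    have h2 : ContDiffAt ℝ 1 (fun x => |f x| ^ p) x := (hf.norm_rpow hp).contDiffAt
    exact ((h1.log hn).mul (h1.rpow_const_of_ne hn)).mul h2

lemma aux_deriv {n : ℕ} {p s : ℝ} (hp : 1 < p) {f : EuclideanSpace ℝ (Fin n) → ℝ}
    (hf : ContDiff ℝ 1 f) {ε : ℝ} (hε : 0 < ε) (h0 : ∀ x, ‖x‖ < ε → f x = 0)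
    (x : EuclideanSpace ℝ (Fin n)) (hx : x ≠ 0) :
    fderiv ℝ (fun x => Real.log ‖x‖ * ‖x‖ ^ s * |f x| ^ p) x x =
      ‖x‖ ^ s * |f x| ^ p + s * (Real.log ‖x‖ * ‖x‖ ^ s * |f x| ^ p)
      + Real.log ‖x‖ * ‖x‖ ^ s * (p * |f x| ^ (p - 2) * f x * fderiv ℝ f x x) := by
  have hn : 0 < ‖x‖ := norm_pos_iff.mpr hx
  have hl : HasDerivAt (fun t : ℝ => t • x) x 1 := by
    simpa using (hasDerivAt_id (1:ℝ)).smul_const x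
  have hN : HasDerivAt (fun t : ℝ => t * ‖x‖) ‖x‖ 1 := by
    simpa using (hasDerivAt_id (1:ℝ)).mul_const ‖x‖
  have d1 : HasDerivAt (fun t : ℝ => (fun x => Real.log ‖x‖ * ‖x‖ ^ s * |f x| ^ p) (t • x))
      (fderiv ℝ (fun x => Real.log ‖x‖ * ‖x‖ ^ s * |f x| ^ p) x x) 1 := by
    have := ((aux_contDiff (s := s) hp hf hε h0).differentiable (by norm_num) x).hasFDerivAt
    exact HasFDerivAt.comp_hasDerivAt (1:ℝ) (by simpa using this) hl
  have df : HasDerivAt (fun t : ℝ => f (t • x)) (fderiv ℝ f x x) 1 := by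
    have := (hf.differentiable (by norm_num) x).hasFDerivAt
    exact HasFDerivAt.comp_hasDerivAt (1:ℝ) (by simpa using this) hl
  have dg : HasDerivAt (fun t : ℝ => |f (t • x)| ^ p) (p * |f x| ^ (p - 2) * f x * fderiv ℝ f x x) 1 := by
    have := hasDerivAt_abs_rpow (f x) hp
    exact HasDerivAt.comp (1:ℝ) (by simpa using this) df
  have d2 := ((hN.log (by simpa using hn.ne')).mul (hN.rpow_const (p := s) (by left; simpa using hn.ne'))).mul dg
  have d3 := d1.unique (d2.congr_of_eventuallyEq ?_)
  · rw [d3]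
    simp only [one_mul, one_smul]
    have : ‖x‖ * s * ‖x‖ ^ (s - 1) = s * ‖x‖ ^ s := by
      rw [rpow_sub_one hn.ne']; field_simp
    rw [this]
    field_simp
    simp
    ring
  · filter_upwards [lt_mem_nhds (zero_lt_one (α := ℝ))] with t ht
    simp [norm_smul, abs_of_pos ht]

lemma aux_hardy {n : ℕ} {p a : ℝ} (hp : 1 < p) (hcrit : (n : ℝ) = p * (1 - a))
    {f : EuclideanSpace ℝ (Fin n) → ℝ}
    (hf : ContDiff ℝ 1 f) (hsupp : HasCompactSupport f)
    {ε : ℝ} (hε : 0 < ε) (h0 : ∀ x, ‖x‖ < ε → f x = 0) :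
    (∫ x, (‖x‖ ^ (a - 1) * |f x|) ^ p) ^ (1 / p) ≤
      p * (∫ x, (‖x‖ ^ a * |Real.log ‖x‖| * ‖fderiv ℝ f x‖) ^ p) ^ (1 / p) := by
  have hp0 : 0 < p := by linarith
  have hp1 : 0 < p - 1 := by linarith
  set s : ℝ := (a - 1) * p with hs
  set φ : EuclideanSpace ℝ (Fin n) → ℝ := fun x => Real.log ‖x‖ * ‖x‖ ^ s * |f x| ^ p with hφ
  set u : EuclideanSpace ℝ (Fin n) → ℝ := fun x => ‖x‖ ^ (a - 1) * |f x| with hu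
  set V : EuclideanSpace ℝ (Fin n) → ℝ :=
    fun x => ‖x‖ ^ a * |Real.log ‖x‖| * ‖fderiv ℝ f x‖ with hV
  have hu0 : ∀ x, 0 ≤ u x := fun x => by positivity
  have hV0 : ∀ x, 0 ≤ V x := fun x => by positivity
  have hnorm : ∀ t : ℝ, ContinuousOn (fun x : EuclideanSpace ℝ (Fin n) => ‖x‖ ^ t) {0}ᶜ := by
    intro t
    exact continuous_norm.continuousOn.rpow_const fun x hx => Or.inl (norm_ne_zero_iff.mpr hx)
  have hlog : ContinuousOn (fun x : EuclideanSpace ℝ (Fin n) => |Real.log ‖x‖|) {0}ᶜ :=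
    (continuous_norm.continuousOn.log fun x hx => norm_ne_zero_iff.mpr hx).abs
  have hfd0 : ∀ x, ‖x‖ < ε → fderiv ℝ f x = 0 := by
    intro x hx
    have : f =ᶠ[nhds x] fun _ => 0 := by
      filter_upwards [(isOpen_lt continuous_norm continuous_const).mem_nhds hx] with y hy
      exact h0 y hy
    rw [this.fderiv_eq]; simp
  have huc : Continuous u := aux_cont (hnorm _) hf.continuous.abs hε
    (fun x hx => by rw [h0 x hx, abs_zero])
  have hVc : Continuous V := aux_cont ((hnorm _).mul hlog)
    (hf.continuous_fderiv (by norm_num)).norm hε (fun x hx => by rw [hfd0 x hx, norm_zero])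
  have hus : HasCompactSupport u := HasCompactSupport.mul_left (hsupp.norm)
  have hVs : HasCompactSupport V := HasCompactSupport.mul_left ((hsupp.fderiv (𝕜 := ℝ)).norm)
  have hUc : Continuous fun x => u x ^ (p - 1) := huc.rpow_const fun x => Or.inr hp1.le
  have hUs : HasCompactSupport fun x => u x ^ (p - 1) :=
    hus.comp_left (g := fun t : ℝ => t ^ (p - 1)) (zero_rpow hp1.ne')
  have hupc : Continuous fun x => u x ^ p := huc.rpow_const fun x => Or.inr hp0.le
  have hups : HasCompactSupport fun x => u x ^ p :=
    hus.comp_left (g := fun t : ℝ => t ^ p) (zero_rpow hp0.ne')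
  have hφ1 : ContDiff ℝ 1 φ := aux_contDiff hp hf hε h0
  have hφs : HasCompactSupport φ := HasCompactSupport.mul_left
    ((hsupp.norm).comp_left (g := fun t : ℝ => t ^ p) (zero_rpow hp0.ne'))
  have hdiv := aux_div hφ1 hφs
  have hI1 : Integrable (fun x => fderiv ℝ φ x x) := by
    have hc : Continuous (fderiv ℝ φ) := hφ1.continuous_fderiv (by norm_num)
    refine Continuous.integrable_of_hasCompactSupport (by fun_prop) ?_
    refine (hφs.fderiv (𝕜 := ℝ)).mono fun x hx => ?_
    simp only [Function.mem_support] at hx ⊢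
    intro h; exact hx (by rw [h]; simp)
  have hI2 : Integrable φ := hφ1.continuous.integrable_of_hasCompactSupport hφs
  have hI3 : Integrable (fun x => u x ^ (p - 1) * V x) :=
    (hUc.mul hVc).integrable_of_hasCompactSupport hVs.mul_left
  have hI4 : Integrable (fun x => u x ^ p) := hupc.integrable_of_hasCompactSupport hups
  have hpt : ∀ x, u x ^ p ≤ fderiv ℝ φ x x + (n:ℝ) * φ x + p * (u x ^ (p - 1) * V x) := by
    intro x
    by_cases hx : x = 0
    · subst hx
      have hf0 : f 0 = 0 := h0 0 (by simpa using hε)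
      have e1 : u 0 = 0 := by simp [hu, hf0]
      have e2 : φ 0 = 0 := by simp [hφ]
      rw [e1, e2, zero_rpow hp0.ne', zero_rpow hp1.ne']; simp
    · have hn : 0 < ‖x‖ := norm_pos_iff.mpr hx
      rw [hφ, aux_deriv hp hf hε h0 x hx]
      have e1 : u x ^ p = ‖x‖ ^ s * |f x| ^ p := by
        simp only [hu]
        rw [mul_rpow (by positivity) (by positivity), ← rpow_mul hn.le]
      have e2 : (n : ℝ) = - s := by rw [hcrit, hs]; ring
      have e3 : u x ^ (p - 1) = ‖x‖ ^ ((a - 1) * (p - 1)) * |f x| ^ (p - 1) := by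
        simp only [hu]
        rw [mul_rpow (by positivity) (by positivity), ← rpow_mul hn.le]
      have e4 : ‖x‖ ^ ((a - 1) * (p - 1)) * ‖x‖ ^ a = ‖x‖ ^ s * ‖x‖ := by
        rw [← rpow_add hn, ← rpow_add_one hn.ne']; congr 1; rw [hs]; ring
      have e5 : |f x| ^ (p - 2) * |f x| = |f x| ^ (p - 1) := by
        rw [← rpow_add_one' (abs_nonneg _) (by linarith)]; congr 1; ring
      have e6 : |fderiv ℝ f x x| ≤ ‖fderiv ℝ f x‖ * ‖x‖ := (fderiv ℝ f x).le_opNorm x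
      have e7 : |Real.log ‖x‖ * ‖x‖ ^ s * (p * |f x| ^ (p - 2) * f x * fderiv ℝ f x x)| ≤
          p * (u x ^ (p - 1) * V x) := by
        calc _ = |Real.log ‖x‖| * ‖x‖ ^ s * (p * (|f x| ^ (p - 2) * |f x|) * |fderiv ℝ f x x|) := by
              simp only [abs_mul, abs_of_pos hp0, abs_of_nonneg (rpow_nonneg (abs_nonneg (f x)) _),
                abs_of_nonneg (rpow_nonneg hn.le _)]
              ring
          _ ≤ |Real.log ‖x‖| * ‖x‖ ^ s * (p * (|f x| ^ (p - 2) * |f x|) * (‖fderiv ℝ f x‖ * ‖x‖)) := by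
              gcongr
          _ = p * |f x| ^ (p - 1) * |Real.log ‖x‖| * ‖fderiv ℝ f x‖ * (‖x‖ ^ s * ‖x‖) := by
              rw [e5]; ring
          _ = _ := by
              rw [← e4, e3]; simp only [hV]; ring
      have e8 := (abs_le.mp e7).1
      rw [e1, e2]
      linarith
  have hA : ∫ x, u x ^ p ≤ p * ∫ x, u x ^ (p - 1) * V x := by
    have hI12 : Integrable (fun x => fderiv ℝ φ x x + (n:ℝ) * φ x) :=
      hI1.add (hI2.const_mul (n:ℝ))
    have hI123 : Integrable (fun x => fderiv ℝ φ x x + (n:ℝ) * φ x + p * (u x ^ (p - 1) * V x)) :=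
      hI12.add (hI3.const_mul p)
    have := integral_mono hI4 hI123 hpt
    rw [integral_add hI12 (hI3.const_mul p), integral_add hI1 (hI2.const_mul (n:ℝ)),
      integral_const_mul, integral_const_mul, hdiv] at this
    linarith
  have hconj : (p / (p - 1)).HolderConjugate p := (Real.HolderConjugate.conjExponent hp).symm
  have hH := integral_mul_le_Lp_mul_Lq_of_nonneg (μ := volume) hconj
    (Filter.Eventually.of_forall fun x => rpow_nonneg (hu0 x) (p - 1))
    (Filter.Eventually.of_forall hV0)
    (hUc.memLp_of_hasCompactSupport hUs) (hVc.memLp_of_hasCompactSupport hVs)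
  have e1 : ∀ x, (u x ^ (p - 1)) ^ (p / (p - 1)) = u x ^ p := by
    intro x; rw [← rpow_mul (hu0 x)]; congr 1; field_simp
  simp_rw [e1] at hH
  have A0 : 0 ≤ ∫ x, u x ^ p := integral_nonneg fun x => rpow_nonneg (hu0 x) _
  have B0 : 0 ≤ ∫ x, V x ^ p := integral_nonneg fun x => rpow_nonneg (hV0 x) _
  generalize (∫ x, u x ^ p) = A at *
  generalize (∫ x, V x ^ p) = B at *
  rcases A0.eq_or_lt with h | h
  · rw [← h, zero_rpow (by positivity)]; positivity
  · have h5 : A ^ (1 / (p / (p - 1))) * A ^ (1 / p) = A := by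
      rw [← rpow_add h]
      conv_rhs => rw [← rpow_one A]
      congr 1; field_simp; ring
    have h6 : 0 < A ^ (1 / (p / (p - 1))) := by positivity
    refine le_of_mul_le_mul_left ?_ h6
    rw [h5]
    calc A ≤ _ := hA
      _ ≤ p * (A ^ (1 / (p / (p - 1))) * B ^ (1 / p)) := by gcongr
      _ = _ := by ring

theorem stmt_4 (n : ℕ) (p q r δ a b c : ℝ)
    (hp : 1 < p) (hq : 1 < q) (hr : 0 < r) (hpqr : r ≤ p + q)
    (hδ0 : 0 ≤ δ) (hδ1 : δ ≤ 1) (hδ2 : (r - q) / r ≤ δ) (hδ3 : δ ≤ p / r)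
    (h1 : δ * r / p + (1 - δ) * r / q = 1) (hc : c = δ * (a - 1) + b * (1 - δ))
    (hcrit : (n : ℝ) = p * (1 - a))
    (f : EuclideanSpace ℝ (Fin n) → ℝ) (hf : ContDiff ℝ (⊤ : ℕ∞) f) (hsupp : HasCompactSupport f)
    (h0 : ∃ ε > (0 : ℝ), ∀ x : EuclideanSpace ℝ (Fin n), ‖x‖ < ε → f x = 0) :
    (∫ x : EuclideanSpace ℝ (Fin n), (‖x‖ ^ c * |f x|) ^ r) ^ (1 / r) ≤
      p ^ δ *
        ((∫ x : EuclideanSpace ℝ (Fin n),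
            (‖x‖ ^ a * |Real.log ‖x‖| * ‖fderiv ℝ f x‖) ^ p) ^ (1 / p)) ^ δ *
        ((∫ x : EuclideanSpace ℝ (Fin n), (‖x‖ ^ b * |f x|) ^ q) ^ (1 / q)) ^ (1 - δ) := by
  obtain ⟨ε, hε, h0⟩ := h0
  have hp0 : 0 < p := by linarith
  have hq0 : 0 < q := by linarith
  have hf1 : ContDiff ℝ 1 f := hf.of_le (by exact_mod_cast le_top)
  have hardy := aux_hardy hp hcrit hf1 hsupp hε h0
  have hf0 : f 0 = 0 := h0 0 (by simpa using hε)
  set B := (∫ x : EuclideanSpace ℝ (Fin n),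
            (‖x‖ ^ a * |Real.log ‖x‖| * ‖fderiv ℝ f x‖) ^ p) ^ (1 / p) with hB
  have hB0 : 0 ≤ B := rpow_nonneg (integral_nonneg fun x => by positivity) _
  rcases hδ0.eq_or_lt with h | hδ0'
  · subst h
    have hrq : r = q := by
      simp at h1
      rwa [div_eq_one_iff_eq hq0.ne'] at h1
    have hcb : c = b := by rw [hc]; ring
    subst hrq hcb
    simp
  rcases hδ1.eq_or_lt with h | hδ1'
  · subst h
    have hrp : r = p := by
      simp at h1
      rwa [div_eq_one_iff_eq hp0.ne'] at h1
    have hca : c = a - 1 := by rw [hc]; ring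
    subst hrp hca
    simpa using hardy
  have hnorm : ∀ t : ℝ, ContinuousOn (fun x : EuclideanSpace ℝ (Fin n) => ‖x‖ ^ t) {0}ᶜ := by
    intro t
    exact continuous_norm.continuousOn.rpow_const fun x hx => Or.inl (norm_ne_zero_iff.mpr hx)
  have hM : ∀ (t k : ℝ) (m : ENNReal), 0 < k →
      MemLp (fun x : EuclideanSpace ℝ (Fin n) => (‖x‖ ^ t * |f x|) ^ k) m := by
    intro t k m hk
    have huc : Continuous fun x => ‖x‖ ^ t * |f x| := aux_cont (hnorm _) hf1.continuous.abs hε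
      (fun x hx => by rw [h0 x hx, abs_zero])
    have hus : HasCompactSupport fun x => ‖x‖ ^ t * |f x| :=
      HasCompactSupport.mul_left (hsupp.norm)
    exact (huc.rpow_const fun x => Or.inr hk.le).memLp_of_hasCompactSupport
      (hus.comp_left (g := fun t : ℝ => t ^ k) (zero_rpow hk.ne'))
  have hd : 0 < 1 - δ := by linarith
  have key := aux_interp (μ := (volume : Measure (EuclideanSpace ℝ (Fin n))))
    (u := fun x => ‖x‖ ^ (a - 1) * |f x|) (v := fun x => ‖x‖ ^ b * |f x|)
    (fun x => by positivity) (fun x => by positivity) hp hq hr hδ0' hδ1' h1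
    (hM _ _ _ (by positivity)) (hM _ _ _ (by positivity))
  have hpt : ∀ x : EuclideanSpace ℝ (Fin n), ‖x‖ ^ c * |f x| =
      (‖x‖ ^ (a - 1) * |f x|) ^ δ * (‖x‖ ^ b * |f x|) ^ (1 - δ) := by
    intro x
    by_cases hx : x = 0
    · subst hx
      simp [hf0, zero_rpow hδ0'.ne']
    · have hn : 0 < ‖x‖ := norm_pos_iff.mpr hx
      have e1 : |f x| = |f x| ^ δ * |f x| ^ (1 - δ) := by
        rw [← rpow_add' (abs_nonneg _) (by norm_num)]; simp
      rw [mul_rpow (by positivity) (by positivity), mul_rpow (by positivity) (by positivity),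
        ← rpow_mul hn.le, ← rpow_mul hn.le, hc, rpow_add hn, mul_comm δ]
      conv_lhs => rw [e1]
      ring
  simp_rw [hpt]
  refine key.trans ?_
  have hC0 : 0 ≤ (∫ x : EuclideanSpace ℝ (Fin n), (‖x‖ ^ b * |f x|) ^ q) ^ (1 / q) :=
    rpow_nonneg (integral_nonneg fun x => by positivity) _
  refine mul_le_mul_of_nonneg_right ?_ (rpow_nonneg hC0 _)
  rw [← mul_rpow hp0.le hB0]
  exact rpow_le_rpow (rpow_nonneg (integral_nonneg fun x => by positivity) _) hardy hδ0
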